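/- arXiv:2205.15646 — 2 statements merged into one kernel-verified Lean document; each statement's English description precedes it below -/
import Mathlib

section
/- Let α_o > 0, let n ≥ 1, and let T : [0,1] × [0,α_o] → ℝ^{n×n} be such that τ ↦ T(ε,τ) is continuous for each ε, the partial derivative ∂T/∂ε exists and is continuous on [0,1] × [0,α_o], and τ ↦ T(0,τ) is continuously differentiable. Then for each ρ > 0 there exists a continuously differentiable T̂ : [0,1] × [0,α_o] → ℝ^{n×n} such that: T̂(0,τ) = T(0,τ) for all τ ∈ [0,α_o]; sup_{τ∈[0,α_o]} |T̂(ε,τ) − T(ε,τ)| ≤ ρ·ε + o(ε) as ε → 0; and ∂T̂/∂τ(ε,τ) → ∂T/∂τ(0,τ) as ε → 0, for every τ ∈ [0,α_o]. -/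
open Filter Set

/-!
STATEMENT 13: Smooth approximation of a matrix-valued function `T(ε,τ)` that is C¹ in
`ε`, continuous in `τ`, and C¹ in `τ` at `ε = 0`: for each `ρ > 0` there is a C¹
function `T̂` with `T̂(0,·) = T(0,·)`, `sup_τ |T̂(ε,τ) − T(ε,τ)| ≤ ρε + o(ε)`, and
`∂T̂/∂τ(ε,τ) → ∂T/∂τ(0,τ)` as `ε → 0`.  Matrices `ℝ^{n×n}` are represented with the
(Frobenius) norm as `EuclideanSpace ℝ (Fin n × Fin n)`.
-/

noncomputable section

/-- A continuous function on a compact interval is uniformly approximated there by `C¹` functions. -/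
theorem ContinuousOn.exists_contDiff_norm_sub_le {E : Type*} [NormedAddCommGroup E]
    [NormedSpace ℝ E] {a b : ℝ} (hab : a ≤ b) {f : ℝ → E}
    (hf : ContinuousOn f (Icc a b)) {ρ : ℝ} (hρ : 0 < ρ) :
    ∃ g : ℝ → E, ContDiff ℝ 1 g ∧ ∀ x ∈ Icc a b, ‖g x - f x‖ ≤ ρ := by
  have hF : Continuous (IccExtend hab ((Icc a b).domRestrict f)) :=
    continuous_IccExtend_iff.2 (continuousOn_iff_continuous_domRestrict.1 hf)
  obtain ⟨g, hg, happrox, -⟩ := hF.exists_contDiff_approx (ε := fun _ => ρ) 1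
    continuous_const fun _ => hρ
  refine ⟨g, hg, fun x hx => ?_⟩
  have h := (happrox x).le
  rwa [dist_eq_norm, IccExtend_of_mem _ _ hx, domRestrict_apply] at h

/-- First-order Taylor estimate in the first variable, uniform over a compact parameter set. -/
theorem exists_forall_norm_taylor_remainder_le {X E : Type*} [PseudoMetricSpace X]
    [NormedAddCommGroup E] [NormedSpace ℝ E] {K : Set X} (hK : IsCompact K)
    {f f' : ℝ → X → E}
    (hf : ∀ e ∈ Icc (0 : ℝ) 1, ∀ x ∈ K,
      HasDerivWithinAt (fun e => f e x) (f' e x) (Icc 0 1) e)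
    (hf' : ContinuousOn (fun p : ℝ × X => f' p.1 p.2) (Icc 0 1 ×ˢ K)) {c : ℝ} (hc : 0 < c) :
    ∃ δ > 0, ∀ e ∈ Icc (0 : ℝ) 1, e < δ → ∀ x ∈ K,
      ‖f e x - f 0 x - e • f' 0 x‖ ≤ c * e := by
  have huc := (isCompact_Icc.prod hK).uniformContinuousOn_of_continuous hf'
  obtain ⟨δ, hδ, hclose⟩ := Metric.uniformContinuousOn_iff.1 huc c hc
  refine ⟨δ, hδ, fun e he heδ x hx => ?_⟩
  have hsub : Icc 0 e ⊆ Icc (0 : ℝ) 1 := Icc_subset_Icc_right he.2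
  have hderiv : ∀ s ∈ Icc 0 e, HasDerivWithinAt (fun s => f s x - s • f' 0 x)
      (f' s x - f' 0 x) (Icc 0 e) s := fun s hs => by
    simpa using ((hf s (hsub hs) x hx).mono hsub).fun_sub
      ((hasDerivWithinAt_id s (Icc 0 e)).smul_const (f' 0 x))
  have hbound : ∀ s ∈ Ico 0 e, ‖f' s x - f' 0 x‖ ≤ c := fun s hs => by
    rw [← dist_eq_norm]
    refine (hclose (s, x) ⟨hsub (Ico_subset_Icc_self hs), hx⟩ (0, x) ⟨by simp, hx⟩ ?_).le
    rw [Prod.dist_eq, dist_self, max_eq_left dist_nonneg, Real.dist_eq, sub_zero,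
      abs_of_nonneg hs.1]
    exact hs.2.trans heδ
  have h := norm_image_sub_le_of_norm_deriv_le_segment' hderiv hbound e ⟨he.1, le_rfl⟩
  simpa [sub_right_comm] using h

theorem stmt_13 (n : ℕ) (αo : ℝ) (hαo : 0 < αo)
    (T : ℝ → ℝ → EuclideanSpace ℝ (Fin n × Fin n))
    -- τ ↦ T(ε,τ) is continuous on [0,αo] for each ε ∈ [0,1]:
    (hTcont : ∀ ε ∈ Icc (0:ℝ) 1, ContinuousOn (fun τ => T ε τ) (Icc 0 αo))
    -- ∂T/∂ε exists and is continuous on [0,1] × [0,αo]: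
    (Tde : ℝ → ℝ → EuclideanSpace ℝ (Fin n × Fin n))
    (hTde : ∀ ε ∈ Icc (0:ℝ) 1, ∀ τ ∈ Icc (0:ℝ) αo,
        HasDerivWithinAt (fun e => T e τ) (Tde ε τ) (Icc (0:ℝ) 1) ε)
    (hTdeCont : ContinuousOn (fun p : ℝ × ℝ => Tde p.1 p.2) (Icc 0 1 ×ˢ Icc 0 αo))
    -- τ ↦ T(0,τ) is continuously differentiable on [0,αo]:
    (T0d : ℝ → EuclideanSpace ℝ (Fin n × Fin n))
    (hT0d : ∀ τ ∈ Icc (0:ℝ) αo,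
        HasDerivWithinAt (fun τ => T 0 τ) (T0d τ) (Icc (0:ℝ) αo) τ)
    (hT0dCont : ContinuousOn T0d (Icc 0 αo)) :
    ∀ ρ > (0:ℝ),
      ∃ (That : ℝ → ℝ → EuclideanSpace ℝ (Fin n × Fin n))
        (Thatde Thatdτ : ℝ → ℝ → EuclideanSpace ℝ (Fin n × Fin n)),
        -- T̂ is continuously differentiable on [0,1] × [0,αo]:
        (∀ ε ∈ Icc (0:ℝ) 1, ∀ τ ∈ Icc (0:ℝ) αo,
          HasDerivWithinAt (fun e => That e τ) (Thatde ε τ) (Icc (0:ℝ) 1) ε ∧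
          HasDerivWithinAt (fun s => That ε s) (Thatdτ ε τ) (Icc (0:ℝ) αo) τ) ∧
        ContinuousOn (fun p : ℝ × ℝ => That p.1 p.2) (Icc 0 1 ×ˢ Icc 0 αo) ∧
        ContinuousOn (fun p : ℝ × ℝ => Thatde p.1 p.2) (Icc 0 1 ×ˢ Icc 0 αo) ∧
        ContinuousOn (fun p : ℝ × ℝ => Thatdτ p.1 p.2) (Icc 0 1 ×ˢ Icc 0 αo) ∧
        -- T̂(0,τ) = T(0,τ):
        (∀ τ ∈ Icc (0:ℝ) αo, That 0 τ = T 0 τ) ∧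
        -- sup_τ |T̂(ε,τ) − T(ε,τ)| ≤ ρ ε + o(ε):
        (∃ o : ℝ → ℝ, Tendsto (fun ε => o ε / ε) (nhdsWithin 0 (Ioi 0)) (nhds 0) ∧
          ∀ ε ∈ Icc (0:ℝ) 1, ∀ τ ∈ Icc (0:ℝ) αo,
            ‖That ε τ - T ε τ‖ ≤ ρ * ε + o ε) ∧
        -- ∂T̂/∂τ(ε,τ) → ∂T/∂τ(0,τ) as ε → 0⁺, for each τ:
        (∀ τ ∈ Icc (0:ℝ) αo,
          Tendsto (fun ε => Thatdτ ε τ) (nhdsWithin 0 (Ioi 0)) (nhds (T0d τ))) := by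
  intro ρ hρ
  have hmem : (0 : ℝ) ∈ Icc (0 : ℝ) 1 := by simp
  have hslice : ContinuousOn (Tde 0) (Icc 0 αo) :=
    hTdeCont.comp (f := fun τ => ((0 : ℝ), τ)) (by fun_prop) fun τ hτ => ⟨hmem, hτ⟩
  obtain ⟨P, hP, happrox⟩ := hslice.exists_contDiff_norm_sub_le hαo.le hρ
  have hPd : Continuous (deriv P) := hP.continuous_deriv le_rfl
  have hPderiv (τ : ℝ) : HasDerivAt P (deriv P τ) τ :=
    (hP.differentiable one_ne_zero τ).hasDerivAt
  have hT0cont := hTcont 0 hmem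
  have hsnd : MapsTo Prod.snd (Icc (0 : ℝ) 1 ×ˢ Icc 0 αo) (Icc 0 αo) := fun p hp => hp.2
  let R : ℝ → ℝ → EuclideanSpace ℝ (Fin n × Fin n) :=
    fun ε τ => T ε τ - T 0 τ - ε • Tde 0 τ
  have hRbdd : ∀ ε ∈ Icc (0 : ℝ) 1, BddAbove (range fun τ : Icc 0 αo => ‖R ε τ‖) :=
    fun ε hε => by
      have hcont : ContinuousOn (fun τ => ‖R ε τ‖) (Icc 0 αo) :=
        (((hTcont ε hε).sub hT0cont).sub (hslice.const_smul ε)).norm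
      simpa [image_eq_range] using isCompact_Icc.bddAbove_image hcont
  refine ⟨fun ε τ => T 0 τ + ε • P τ, fun _ τ => P τ, fun ε τ => T0d τ + ε • deriv P τ,
    fun ε hε τ hτ => ⟨?_, ?_⟩, ?_, ?_, ?_, fun τ _ => by simp, ?_, fun τ _ => ?_⟩
  · simpa using ((hasDerivWithinAt_id ε (Icc 0 1)).smul_const (P τ)).const_add (T 0 τ)
  · exact (hT0d τ hτ).add ((hPderiv τ).hasDerivWithinAt.const_smul ε)
  · exact (hT0cont.comp continuousOn_snd hsnd).add
      (continuous_fst.smul (hP.continuous.comp continuous_snd)).continuousOn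
  · exact (hP.continuous.comp continuous_snd).continuousOn
  · exact (hT0dCont.comp continuousOn_snd hsnd).add
      (continuous_fst.smul (hPd.comp continuous_snd)).continuousOn
  · refine ⟨fun ε => ⨆ τ : Icc 0 αo, ‖R ε τ‖, ?_, fun ε hε τ hτ => ?_⟩
    · rw [Metric.tendsto_nhdsWithin_nhds]
      intro c hc
      obtain ⟨δ, hδ, hR⟩ :=
        exists_forall_norm_taylor_remainder_le isCompact_Icc hTde hTdeCont (half_pos hc)
      refine ⟨min δ 1, lt_min hδ one_pos, fun {ε} hε hdist => ?_⟩
      have hεpos : 0 < ε := hε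
      rw [Real.dist_eq, sub_zero, abs_of_pos hεpos, lt_min_iff] at hdist
      have hle : ⨆ τ : Icc 0 αo, ‖R ε τ‖ ≤ c / 2 * ε :=
        Real.iSup_le (fun τ => hR ε ⟨hεpos.le, hdist.2.le⟩ hdist.1 τ τ.2) (by positivity)
      have hnonneg : 0 ≤ ⨆ τ : Icc 0 αo, ‖R ε τ‖ := Real.iSup_nonneg fun _ => norm_nonneg _
      rw [Real.dist_eq, sub_zero, abs_of_nonneg (div_nonneg hnonneg hεpos.le)]
      exact ((div_le_iff₀ hεpos).2 hle).trans_lt (half_lt_self hc)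
    · have hsplit : T 0 τ + ε • P τ - T ε τ = ε • (P τ - Tde 0 τ) - R ε τ := by
        simp only [R, smul_sub]
        abel
      calc ‖T 0 τ + ε • P τ - T ε τ‖ ≤ ‖ε • (P τ - Tde 0 τ)‖ + ‖R ε τ‖ :=
            hsplit ▸ norm_sub_le _ _
        _ ≤ ρ * ε + ⨆ τ : Icc 0 αo, ‖R ε τ‖ := by
            refine add_le_add ?_ (le_ciSup (hRbdd ε hε) ⟨τ, hτ⟩)
            rw [norm_smul, Real.norm_of_nonneg hε.1, mul_comm]
            exact mul_le_mul_of_nonneg_right (happrox τ hτ) hε.1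
  · have hcont : Continuous fun ε : ℝ => T0d τ + ε • deriv P τ := by fun_prop
    exact (hcont.tendsto' 0 _ (by simp)).mono_left nhdsWithin_le_nhds
end
end

section
/- Let f : ℝⁿ → ℝⁿ be continuously differentiable, let S₀ ⊆ ℝⁿ and T > 0 be such that for each x₀ ∈ S₀ the (unique) solution x(·;x₀) of ẋ = f(x) with x(0;x₀) = x₀ exists on [0,T]. For t ∈ [0,T] define the reachable set R^b(t,S₀) := { x(t;x₀) : x₀ ∈ S₀ }. If there exists τ ∈ [0,T] such that R^b(τ,S₀) has Lebesgue measure zero, then S₀ has Lebesgue measure zero. -/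
open MeasureTheory Set

/-- A set whose image under an expanding map (up to a constant) is null is itself null. -/
theorem MeasureTheory.Measure.addHaar_eq_zero_of_dist_le_mul_of_image {E : Type*}
    [NormedAddCommGroup E] [NormedSpace ℝ E] [FiniteDimensional ℝ E] [MeasurableSpace E]
    [BorelSpace E] (μ : Measure E) [μ.IsAddHaarMeasure] {φ : E → E} {s : Set E} {C : NNReal}
    (hφ : ∀ x ∈ s, ∀ y ∈ s, dist x y ≤ C * dist (φ x) (φ y)) (hs : μ (φ '' s) = 0) :
    μ s = 0 := by
  have hinj : InjOn φ s := fun x hx y hy hxy => by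
    simpa [hxy] using hφ x hx y hy
  have hlip : LipschitzOnWith C (Function.invFunOn φ s) (φ '' s) := by
    refine LipschitzOnWith.of_dist_le_mul ?_
    rintro _ ⟨x, hx, rfl⟩ _ ⟨y, hy, rfl⟩
    simpa only [hinj.leftInvOn_invFunOn hx, hinj.leftInvOn_invFunOn hy] using hφ x hx y hy
  have hle := hlip.hausdorffMeasure_image_le (Nat.cast_nonneg (Module.finrank ℝ E))
  rw [hinj.leftInvOn_invFunOn.image_image,
    Measure.absolutelyContinuous_isAddHaarMeasure _ μ hs, mul_zero] at hle
  exact Measure.absolutelyContinuous_isAddHaarMeasure μ _ (le_zero_iff.mp hle)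

theorem HasDerivWithinAt.comp_const_sub_Icc {E : Type*} [NormedAddCommGroup E] [NormedSpace ℝ E]
    {γ : ℝ → E} {γ' : E} {T τ t : ℝ} (hτ : τ ≤ T)
    (h : HasDerivWithinAt γ γ' (Icc 0 T) (τ - t)) :
    HasDerivWithinAt (fun s => γ (τ - s)) (-γ') (Icc 0 τ) t := by
  have hsub : HasDerivWithinAt (fun s => τ - s) (-1) (Icc 0 τ) t :=
    (hasDerivWithinAt_id t _).const_sub τ
  have hmaps : MapsTo (fun s => τ - s) (Icc 0 τ) (Icc 0 T) := fun s hs =>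
    ⟨sub_nonneg.mpr hs.2, by linarith [hs.1]⟩
  simpa [Function.comp_def] using HasDerivWithinAt.scomp t h hsub hmaps

/-- Two trajectories of an autonomous ODE that stay in a set on which the vector field is
Lipschitz separate at most exponentially fast backwards in time. -/
theorem dist_zero_le_of_trajectories_ODE_of_mem {E : Type*} [NormedAddCommGroup E]
    [NormedSpace ℝ E] {f : E → E} {s : Set E} {K : NNReal} {γ₁ γ₂ : ℝ → E} {T τ : ℝ}
    (hf : LipschitzOnWith K f s) (hτ : τ ∈ Icc 0 T)
    (h₁ : ∀ t ∈ Icc 0 T, HasDerivWithinAt γ₁ (f (γ₁ t)) (Icc 0 T) t)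
    (hs₁ : ∀ t ∈ Icc 0 T, γ₁ t ∈ s)
    (h₂ : ∀ t ∈ Icc 0 T, HasDerivWithinAt γ₂ (f (γ₂ t)) (Icc 0 T) t)
    (hs₂ : ∀ t ∈ Icc 0 T, γ₂ t ∈ s) :
    dist (γ₁ 0) (γ₂ 0) ≤ Real.exp (K * τ) * dist (γ₁ τ) (γ₂ τ) := by
  have hmem : ∀ t ∈ Icc 0 τ, τ - t ∈ Icc 0 T := fun t ht =>
    ⟨sub_nonneg.mpr ht.2, by linarith [ht.1, hτ.2]⟩
  have hderiv : ∀ γ : ℝ → E, (∀ t ∈ Icc 0 T, HasDerivWithinAt γ (f (γ t)) (Icc 0 T) t) →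
      ∀ t ∈ Icc 0 τ, HasDerivWithinAt (fun s => γ (τ - s)) (-f (γ (τ - t))) (Icc 0 τ) t :=
    fun γ h t ht => (h _ (hmem t ht)).comp_const_sub_Icc hτ.2
  have hright : ∀ γ : ℝ → E, (∀ t ∈ Icc 0 T, HasDerivWithinAt γ (f (γ t)) (Icc 0 T) t) →
      ∀ t ∈ Ico 0 τ, HasDerivWithinAt (fun s => γ (τ - s)) (-f (γ (τ - t))) (Ici t) t :=
    fun γ h t ht => (hderiv γ h t (Ico_subset_Icc_self ht)).mono_of_mem_nhdsWithin
      (Icc_mem_nhdsGE_of_mem ht)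
  have hgronwall := dist_le_of_trajectories_ODE_of_mem (v := fun _ y => -f y) (s := fun _ => s)
    (K := K) (a := 0) (b := τ) (fun _ _ => hf.neg)
    (fun t ht => (hderiv γ₁ h₁ t ht).continuousWithinAt) (hright γ₁ h₁)
    (fun t ht => hs₁ _ (hmem t (Ico_subset_Icc_self ht)))
    (fun t ht => (hderiv γ₂ h₂ t ht).continuousWithinAt) (hright γ₂ h₂)
    (fun t ht => hs₂ _ (hmem t (Ico_subset_Icc_self ht))) le_rfl τ ⟨hτ.1, le_rfl⟩
  simpa [mul_comm] using hgronwall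

/-!
STATEMENT 14: Let `f : ℝⁿ → ℝⁿ` be C¹, `S₀ ⊆ ℝⁿ`, `T > 0`, and suppose for each
`x₀ ∈ S₀` the solution `x(·;x₀)` of `ẋ = f(x)`, `x(0) = x₀` exists on `[0,T]`.
If the reachable set `R^b(τ,S₀) = {x(τ;x₀) : x₀ ∈ S₀}` is Lebesgue-null for some
`τ ∈ [0,T]`, then `S₀` is Lebesgue-null.
-/

theorem stmt_14 (n : ℕ)
    (f : EuclideanSpace ℝ (Fin n) → EuclideanSpace ℝ (Fin n))
    (hf : ContDiff ℝ 1 f)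
    (S₀ : Set (EuclideanSpace ℝ (Fin n))) (T : ℝ) (hT : 0 < T)
    (x : EuclideanSpace ℝ (Fin n) → ℝ → EuclideanSpace ℝ (Fin n))
    (hx0 : ∀ x₀ ∈ S₀, x x₀ 0 = x₀)
    (hx : ∀ x₀ ∈ S₀, ∀ t ∈ Set.Icc (0:ℝ) T,
        HasDerivWithinAt (x x₀) (f (x x₀ t)) (Set.Icc (0:ℝ) T) t)
    (τ : ℝ) (hτ : τ ∈ Set.Icc (0:ℝ) T)
    (hnull : MeasureTheory.volume ((fun x₀ => x x₀ τ) '' S₀) = 0) :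
    MeasureTheory.volume S₀ = 0 := by
  let A : ℕ → Set (EuclideanSpace ℝ (Fin n)) := fun N =>
    {x₀ ∈ S₀ | ∀ t ∈ Icc 0 T, x x₀ t ∈ Metric.closedBall 0 (N : ℝ)}
  have hcover : S₀ ⊆ ⋃ N, A N := by
    intro x₀ hx₀
    have hcont : ContinuousOn (x x₀) (Icc 0 T) := fun t ht => (hx x₀ hx₀ t ht).continuousWithinAt
    obtain ⟨R, hR⟩ := isCompact_Icc.exists_bound_of_continuousOn hcont
    obtain ⟨N, hN⟩ := exists_nat_ge R
    exact mem_iUnion.mpr ⟨N, hx₀, fun t ht => mem_closedBall_zero_iff.mpr ((hR t ht).trans hN)⟩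
  refine measure_mono_null hcover (measure_iUnion_null fun N => ?_)
  obtain ⟨K, hK⟩ := hf.locallyLipschitz.locallyLipschitzOn.exists_lipschitzOnWith_of_compact
    (isCompact_closedBall (0 : EuclideanSpace ℝ (Fin n)) N)
  refine Measure.addHaar_eq_zero_of_dist_le_mul_of_image volume
    (φ := fun x₀ => x x₀ τ) (C := (Real.exp (K * τ)).toNNReal) ?_
    (measure_mono_null (image_mono fun x₀ hx₀ => hx₀.1) hnull)
  intro a ha b hb
  simpa [hx0 a ha.1, hx0 b hb.1, (Real.exp_pos _).le] using dist_zero_le_of_trajectories_ODE_of_mem hK hτ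
    (hx a ha.1) ha.2 (hx b hb.1) hb.2
end
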